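/- Assume τ_n^{s,t} ≠ 0, τ_{n−1}^{s,t} ≠ 0 and σ_{n−1}^{s,t} ≠ 0, and let n ≥ 1. Then the auxiliary polynomial R_n^{s,t} satisfies: (i) ⟨R_n^{s,t}(x), y^i⟩_{s,t} = 0 for all 0 ≤ i ≤ n−2; (ii) L_{s,t}(R_n^{s,t}) = 0; and (iii) R_n^{s,t}(x) = P_n^{s,t}(x) + e_n^{s,t} P_{n−1}^{s,t}(x), where e_n^{s,t} = −σ_n^{s,t}τ_{n−1}^{s,t}/(σ_{n−1}^{s,t}τ_n^{s,t}). -/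

import Mathlib

open MeasureTheory

/-- Bimoments `m_{i,j}^{s,t}` of the Cauchy-Jacobi weight. -/
noncomputable def mom (s t i j : ℕ) : ℝ :=
  ∫ p in (Set.Ioo (0:ℝ) 1 ×ˢ Set.Ioo (0:ℝ) 1),
    (p.1 ^ (s + i) * p.2 ^ (s + j) / (p.1 + p.2)) *
      ((1 - p.1) / (1 + p.1)) ^ t * ((1 - p.2) / (1 + p.2)) ^ t

/-- Single moments `φ_i^{s,t} = L_{s,t}(x^i)`. -/
noncomputable def phi (s t i : ℕ) : ℝ :=
  Real.sqrt 2 * ∫ x in Set.Ioo (0:ℝ) 1,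
    (x ^ (s + i) / (1 + x)) * ((1 - x) / (1 + x)) ^ t

/-- Single moments `m_i^{s,t}`. -/
noncomputable def momS (s t i : ℕ) : ℝ :=
  ∫ x in Set.Ioo (0:ℝ) 1, x ^ (s + i) * ((1 - x) / (1 + x)) ^ t

/-- `τ_n^{s,t} = det(m_{i,j}^{s,t})_{i,j=0}^{n-1}` (with `τ_0^{s,t} = 1`). -/
noncomputable def tau (s t n : ℕ) : ℝ :=
  Matrix.det (Matrix.of fun i j : Fin n => mom s t i j)

/-- `ξ_n^{s,t} = det(m_{i,j+1}^{s,t})_{i,j=0}^{n-1}` (with `ξ_0^{s,t} = 1`). -/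
noncomputable def xi (s t n : ℕ) : ℝ :=
  Matrix.det (Matrix.of fun i j : Fin n => mom s t i ((j : ℕ) + 1))

/-- `σ_n^{s,t}`: determinant of the `(n+1)×(n+1)` matrix with first `n` columns the
bimoments and last column `(φ_0^{s,t},…,φ_n^{s,t})`. -/
noncomputable def sig (s t n : ℕ) : ℝ :=
  Matrix.det (Matrix.of fun i j : Fin (n + 1) =>
    if (j : ℕ) < n then mom s t i j else phi s t i)

/-- `ψ_n^{s,t}`: like `σ_n^{s,t}` but with shifted bimoments `m_{i,j+1}^{s,t}`. -/
noncomputable def psi (s t n : ℕ) : ℝ :=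
  Matrix.det (Matrix.of fun i j : Fin (n + 1) =>
    if (j : ℕ) < n then mom s t i ((j : ℕ) + 1) else phi s t i)

/-- `σ̃_n^{s,t}`: determinant of the `(n+1)×(n+1)` matrix with first `n` columns the
bimoments and last column the single moments `(m_0^{s,t},…,m_n^{s,t})`. -/
noncomputable def sigT (s t n : ℕ) : ℝ :=
  Matrix.det (Matrix.of fun i j : Fin (n + 1) =>
    if (j : ℕ) < n then mom s t i j else momS s t i)

/-- `τ̃_n^{s,t}`: determinant of the `n×n` matrix whose rows are the bimoment rows
`i = 0,…,n−2,n`. -/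
noncomputable def tauT (s t n : ℕ) : ℝ :=
  Matrix.det (Matrix.of fun i j : Fin n =>
    mom s t (if (i : ℕ) < n - 1 then (i : ℕ) else n) j)

/-- The monic Cauchy-Jacobi orthogonal polynomial `P_n^{s,t}` (as a real function). -/
noncomputable def P (s t n : ℕ) (x : ℝ) : ℝ :=
  (1 / tau s t n) * Matrix.det (Matrix.of fun i j : Fin (n + 1) =>
    if (j : ℕ) < n then mom s t i j else x ^ (i : ℕ))

/-- The adjacent monic polynomial `Q_n^{s,t}` (as a real function). -/
noncomputable def Q (s t n : ℕ) (x : ℝ) : ℝ :=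
  (1 / xi s t n) * Matrix.det (Matrix.of fun i j : Fin (n + 1) =>
    if (j : ℕ) < n then mom s t i ((j : ℕ) + 1) else x ^ (i : ℕ))

/-- The auxiliary monic polynomial `R_n^{s,t}` (as a real function): first column
`(φ_0,…,φ_n)`, next `n−1` columns the bimoments `m_{i,j}` for `j = 0,…,n−2`,
last column `(1,x,…,x^n)`, normalized by `(−1)^{n−1}/σ_{n−1}^{s,t}`. -/
noncomputable def R (s t n : ℕ) (x : ℝ) : ℝ :=
  ((-1 : ℝ) ^ (n - 1) / sig s t (n - 1)) *
    Matrix.det (Matrix.of fun i j : Fin (n + 1) =>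
      if (j : ℕ) = 0 then phi s t i
      else if (j : ℕ) < n then mom s t i ((j : ℕ) - 1) else x ^ (i : ℕ))

/-- The two-parameter deformed Cauchy inner product `⟨f,g⟩_{s,t}` on real functions. -/
noncomputable def innerF (s t : ℕ) (f g : ℝ → ℝ) : ℝ :=
  ∫ p in (Set.Ioo (0:ℝ) 1 ×ˢ Set.Ioo (0:ℝ) 1),
    (p.1 ^ s * p.2 ^ s / (p.1 + p.2)) * f p.1 * g p.2 *
      ((1 - p.1) / (1 + p.1)) ^ t * ((1 - p.2) / (1 + p.2)) ^ t

/-- The two-parameter deformed Cauchy inner product on real polynomials. -/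
noncomputable def innerP (s t : ℕ) (f g : Polynomial ℝ) : ℝ :=
  innerF s t (fun x => f.eval x) (fun y => g.eval y)

/-- The linear functional `L_{s,t}` on real functions. -/
noncomputable def LF (s t : ℕ) (f : ℝ → ℝ) : ℝ :=
  Real.sqrt 2 * ∫ x in Set.Ioo (0:ℝ) 1,
    (x ^ s / (1 + x)) * f x * ((1 - x) / (1 + x)) ^ t

/-- The linear functional `L_{s,t}` on real polynomials. -/
noncomputable def LP (s t : ℕ) (f : Polynomial ℝ) : ℝ := LF s t (fun x => f.eval x)

/-- The weighted monomials defining `mom` are integrable on the open unit square. -/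
theorem integrableOn_mom (s t i j : ℕ) :
    IntegrableOn (fun p : ℝ × ℝ => (p.1 ^ (s + i) * p.2 ^ (s + j) / (p.1 + p.2)) *
      ((1 - p.1) / (1 + p.1)) ^ t * ((1 - p.2) / (1 + p.2)) ^ t)
      (Set.Ioo (0:ℝ) 1 ×ˢ Set.Ioo (0:ℝ) 1) := by
  have h1 : Integrable (fun x : ℝ => x ^ (-(1/2) : ℝ))
      (volume.restrict (Set.Ioo (0:ℝ) 1)) := by
    have h := intervalIntegral.intervalIntegrable_rpow' (a := 0) (b := 1)
      (r := (-(1/2) : ℝ)) (by norm_num)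
    rw [intervalIntegrable_iff_integrableOn_Ioo_of_le zero_le_one] at h
    exact h
  have h2 := h1.mul_prod h1
  rw [Measure.prod_restrict] at h2
  refine Integrable.mono' h2 (Measurable.aestronglyMeasurable (by fun_prop)) ?_
  refine (ae_restrict_iff' (measurableSet_Ioo.prod measurableSet_Ioo)).2 (.of_forall ?_)
  rintro ⟨x, y⟩ ⟨⟨hx0, hx1⟩, ⟨hy0, hy1⟩⟩
  simp only at hx0 hx1 hy0 hy1 ⊢
  have hw : ∀ z : ℝ, 0 < z → z < 1 →
      0 ≤ ((1 - z) / (1 + z)) ^ t ∧ ((1 - z) / (1 + z)) ^ t ≤ 1 := by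
    intro z hz0 hz1
    have h0 : 0 ≤ (1 - z) / (1 + z) := div_nonneg (by linarith) (by linarith)
    exact ⟨pow_nonneg h0 t, pow_le_one₀ h0 ((div_le_one (by linarith)).2 (by linarith))⟩
  obtain ⟨hwx0, hwx1⟩ := hw x hx0 hx1
  obtain ⟨hwy0, hwy1⟩ := hw y hy0 hy1
  have hxy : 0 < x + y := by linarith
  have hnum : x ^ (s + i) * y ^ (s + j) ≤ 1 :=
    mul_le_one₀ (pow_le_one₀ hx0.le hx1.le) (by positivity) (pow_le_one₀ hy0.le hy1.le)
  rw [Real.norm_of_nonneg (by positivity)]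
  have hsx : x ^ (-(1/2) : ℝ) = (√x)⁻¹ := by rw [Real.rpow_neg hx0.le, Real.sqrt_eq_rpow]
  have hsy : y ^ (-(1/2) : ℝ) = (√y)⁻¹ := by rw [Real.rpow_neg hy0.le, Real.sqrt_eq_rpow]
  rw [hsx, hsy, ← mul_inv]
  have hsx0 := Real.sqrt_pos.2 hx0
  have hsy0 := Real.sqrt_pos.2 hy0
  have hle : √x * √y ≤ x + y := by
    nlinarith [Real.sq_sqrt hx0.le, Real.sq_sqrt hy0.le, sq_nonneg (√x - √y)]
  calc _ ≤ x ^ (s + i) * y ^ (s + j) / (x + y) * 1 * 1 := by gcongr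
    _ ≤ 1 / (x + y) := by rw [mul_one, mul_one]; gcongr
    _ ≤ (√x * √y)⁻¹ := by rw [one_div]; gcongr

/-- The weighted monomials defining `phi` are integrable on the open unit interval. -/
theorem integrableOn_phi (s t i : ℕ) :
    IntegrableOn (fun x : ℝ => (x ^ (s + i) / (1 + x)) * ((1 - x) / (1 + x)) ^ t)
      (Set.Ioo (0:ℝ) 1) := by
  have h : ContinuousOn (fun x : ℝ => (x ^ (s + i) / (1 + x)) * ((1 - x) / (1 + x)) ^ t)
      (Set.Icc (0:ℝ) 1) := by
    have hne : ∀ x ∈ Set.Icc (0:ℝ) 1, 1 + x ≠ 0 := fun x hx => by linarith [hx.1]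
    fun_prop (disch := assumption)
  exact h.integrableOn_Icc.mono_set Set.Ioo_subset_Icc_self

theorem innerF_sum_pow (s t j : ℕ) {n : ℕ} (c : Fin n → ℝ) :
    innerF s t (fun x => ∑ i, c i * x ^ (i : ℕ)) (fun y => y ^ j) =
      ∑ i, c i * mom s t i j := by
  simp only [innerF, mom]
  simp_rw [← integral_const_mul]
  rw [← integral_finsetSum _ fun (i : Fin n) _ => (integrableOn_mom s t i j).const_mul (c i)]
  refine integral_congr_ae (.of_forall fun p => ?_)
  simp only [Finset.mul_sum, Finset.sum_mul]
  refine Finset.sum_congr rfl fun i _ => ?_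
  ring

theorem LF_sum_pow (s t : ℕ) {n : ℕ} (c : Fin n → ℝ) :
    LF s t (fun x => ∑ i, c i * x ^ (i : ℕ)) = ∑ i, c i * phi s t i := by
  simp only [LF, phi]
  simp_rw [mul_left_comm _ (√2), ← Finset.mul_sum]
  congr 1
  simp_rw [← integral_const_mul]
  rw [← integral_finsetSum _ fun (i : Fin n) _ => (integrableOn_phi s t i).const_mul (c i)]
  refine integral_congr_ae (.of_forall fun p => ?_)
  simp only [Finset.mul_sum, Finset.sum_mul]
  refine Finset.sum_congr rfl fun i _ => ?_
  ring

/-- The determinant of order `n + 1` with columns `a 0, …, a (n - 1), v`. -/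
noncomputable def borderedDet (a : ℕ → ℕ → ℝ) (n : ℕ) (v : ℕ → ℝ) : ℝ :=
  Matrix.det (Matrix.of fun i j : Fin (n + 1) => if (j : ℕ) < n then a j i else v i)

theorem borderedDet_self (a : ℕ → ℕ → ℝ) {n j : ℕ} (hj : j < n) :
    borderedDet a n (a j) = 0 := by
  refine Matrix.det_zero_of_column_eq
    (i := ⟨j, by omega⟩) (j := Fin.last n) (by simp [Fin.ext_iff]; omega) fun i => ?_
  simp [hj]

theorem borderedDet_eq_det (a : ℕ → ℕ → ℝ) (n : ℕ) :
    borderedDet a n (a n) = Matrix.det (Matrix.of fun i j : Fin (n + 1) => a j i) := by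
  unfold borderedDet
  congr 1
  ext i j
  simp only [Matrix.of_apply, ite_eq_left_iff, not_lt]
  intro h
  rw [show (j : ℕ) = n by omega]

theorem borderedDet_eq_sum (a : ℕ → ℕ → ℝ) (n : ℕ) :
    ∃ c : Fin (n + 1) → ℝ, c (Fin.last n) = Matrix.det (Matrix.of fun i j : Fin n => a j i) ∧
      ∀ v, borderedDet a n v = ∑ i, c i * v i := by
  refine ⟨fun i => (-1) ^ (i + n : ℕ) *
    Matrix.det (Matrix.of fun (k l : Fin n) => a l (i.succAbove k)), ?_, fun v => ?_⟩
  · simp [← two_mul]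
  · rw [borderedDet, Matrix.det_succ_column _ (Fin.last n)]
    refine Finset.sum_congr rfl fun i _ => ?_
    simp [Matrix.submatrix, mul_right_comm]

/-- Moving the first column of a determinant to the last position. -/
theorem det_cons_column (a : ℕ → ℕ → ℝ) (v : ℕ → ℝ) (n : ℕ) :
    Matrix.det (Matrix.of fun i j : Fin (n + 1) => if (j : ℕ) = 0 then v i else a (j - 1) i) =
      (-1) ^ n * borderedDet a n v := by
  rw [borderedDet, Matrix.det_succ_column _ 0, Matrix.det_succ_column _ (Fin.last n),
    Finset.mul_sum]
  refine Finset.sum_congr rfl fun i _ => ?_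
  have h : (-1 : ℝ) ^ n * (-1) ^ n = 1 := by rw [← mul_pow]; simp
  simp [Matrix.submatrix, pow_add]
  linear_combination (-(-1) ^ (i : ℕ) * v i *
    Matrix.det (Matrix.of fun (k l : Fin n) => a l (i.succAbove k))) * h

/-- A linear functional vanishing on the last basis vector and on `n` vectors whose truncations
are independent is zero. -/
theorem eq_zero_of_sum_eq_zero {a : ℕ → ℕ → ℝ} {n : ℕ}
    (ha : Matrix.det (Matrix.of fun i j : Fin n => a j i) ≠ 0) {c : Fin (n + 1) → ℝ}
    (hlast : c (Fin.last n) = 0) (hc : ∀ j < n, ∑ i, c i * a j i = 0) : c = 0 := by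
  have h : (fun i : Fin n => c i.castSucc) = 0 := by
    refine Matrix.eq_zero_of_vecMul_eq_zero ha (funext fun j => ?_)
    have := hc j j.2
    rw [Fin.sum_univ_castSucc, hlast] at this
    simpa [Matrix.vecMul, dotProduct] using this
  funext i
  refine Fin.lastCases hlast (fun i => congrFun h i) i

/-- A three-term Plücker relation, expanded along the common last column `v`. -/
theorem borderedDet_plucker (a : ℕ → ℕ → ℝ) (f : ℕ → ℝ) (k : ℕ)
    (ha : Matrix.det (Matrix.of fun i j : Fin (k + 1) => a j i) ≠ 0) (v : ℕ → ℝ) :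
    (-1) ^ k * borderedDet (fun j => if j = 0 then f else a (j - 1)) (k + 1) v *
        borderedDet a k (a k) =
      borderedDet a (k + 1) v * borderedDet a k f -
        borderedDet a (k + 1) f * borderedDet a k v := by
  set r : ℕ → ℕ → ℝ := fun j => if j = 0 then f else a (j - 1) with hr
  have hdr : ∀ m, Matrix.det (Matrix.of fun i j : Fin (m + 1) => r j i) =
      (-1) ^ m * borderedDet a m f := by
    intro m
    rw [← det_cons_column]
    congr 1
    ext i j
    simp only [hr, Matrix.of_apply]
    split_ifs <;> rfl
  have hsq : (-1 : ℝ) ^ k * (-1) ^ k = 1 := by rw [← mul_pow]; simp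
  obtain ⟨cr, hcr, hr'⟩ := borderedDet_eq_sum r (k + 1)
  obtain ⟨ca, hca, ha'⟩ := borderedDet_eq_sum a (k + 1)
  obtain ⟨cb, -, hb'⟩ := borderedDet_eq_sum a k
  let c : Fin (k + 2) → ℝ := fun i => (-1) ^ k * cr i * borderedDet a k (a k) -
    ca i * borderedDet a k f + borderedDet a (k + 1) f * Fin.snoc (α := fun _ => ℝ) cb 0 i
  have hsum : ∀ w : ℕ → ℝ, ∑ i, c i * w i =
      (-1) ^ k * borderedDet r (k + 1) w * borderedDet a k (a k) -
        borderedDet a (k + 1) w * borderedDet a k f +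
        borderedDet a (k + 1) f * borderedDet a k w := by
    intro w
    have hs : borderedDet a k w = ∑ i : Fin (k + 2), Fin.snoc (α := fun _ => ℝ) cb 0 i * w i := by
      rw [hb', Fin.sum_univ_castSucc (n := k + 1)]
      simp
    rw [hs, hr' w, ha' w]
    simp only [c, Finset.mul_sum, Finset.sum_mul, ← Finset.sum_sub_distrib,
      ← Finset.sum_add_distrib]
    refine Finset.sum_congr rfl fun i _ => ?_
    ring
  have hc : c = 0 := by
    refine eq_zero_of_sum_eq_zero ha ?_ fun j hj => ?_
    · simp only [c, hcr, hca, hdr, Fin.snoc_last, ← borderedDet_eq_det]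
      linear_combination (borderedDet a k f * borderedDet a k (a k)) * hsq
    · rw [hsum, borderedDet_self a hj]
      rcases Nat.lt_succ_iff_lt_or_eq.1 hj with hj | rfl
      · rw [borderedDet_self a hj, show a j = r (j + 1) by simp [hr],
          borderedDet_self r (by omega)]
        ring
      · rw [show borderedDet r (j + 1) (a j) = (-1) ^ (j + 1) * borderedDet a (j + 1) f by
          rw [← hdr, ← borderedDet_eq_det]; simp [hr]]
        linear_combination (-borderedDet a (j + 1) f * borderedDet a j (a j)) * hsq
  have := hsum v
  simp only [hc, Pi.zero_apply, zero_mul, Finset.sum_const_zero] at this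
  linarith

theorem R_succ_eq (s t k : ℕ) (x : ℝ) :
    R s t (k + 1) x = (-1) ^ k / sig s t k *
      borderedDet (fun j => if j = 0 then phi s t else fun i => mom s t i (j - 1)) (k + 1)
        (fun i => x ^ i) := by
  simp only [R, borderedDet, Nat.add_sub_cancel]
  congr 2
  ext i j
  simp only [Matrix.of_apply]
  by_cases h : (j : ℕ) = 0 <;> simp [h]

/-- the auxiliary polynomial `R_n^{s,t}` satisfies
(i) `⟨R_n^{s,t}, y^i⟩_{s,t} = 0` for `0 ≤ i ≤ n−2`, (ii) `L_{s,t}(R_n^{s,t}) = 0`, and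
(iii) `R_n^{s,t} = P_n^{s,t} + e_n^{s,t}P_{n−1}^{s,t}` with
`e_n^{s,t} = −σ_n^{s,t}τ_{n−1}^{s,t}/(σ_{n−1}^{s,t}τ_n^{s,t})`. -/
theorem R_properties (s t n : ℕ) (hn : 1 ≤ n)
    (h₁ : tau s t n ≠ 0) (h₂ : tau s t (n - 1) ≠ 0) (h₃ : sig s t (n - 1) ≠ 0) :
    (∀ i : ℕ, i + 2 ≤ n → innerF s t (R s t n) (fun y => y ^ i) = 0) ∧
      LF s t (R s t n) = 0 ∧
      ∀ x : ℝ, R s t n x =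
        P s t n x +
          (-(sig s t n * tau s t (n - 1)) / (sig s t (n - 1) * tau s t n)) *
            P s t (n - 1) x := by
  obtain ⟨k, rfl⟩ : ∃ k, n = k + 1 := ⟨n - 1, by omega⟩
  simp only [Nat.add_sub_cancel] at h₂ h₃ ⊢
  set r : ℕ → ℕ → ℝ := fun j => if j = 0 then phi s t else fun i => mom s t i (j - 1) with hr
  obtain ⟨c, -, hc⟩ := borderedDet_eq_sum r (k + 1)
  have hR : R s t (k + 1) = fun x => ∑ i, ((-1) ^ k / sig s t k * c i) * x ^ (i : ℕ) := by
    funext x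
    rw [R_succ_eq, hc, Finset.mul_sum]
    exact Finset.sum_congr rfl fun i _ => (mul_assoc _ _ _).symm
  refine ⟨fun i hi => ?_, ?_, fun x => ?_⟩
  · have h := hc (r (i + 1))
    rw [borderedDet_self r (by omega)] at h
    rw [hR, innerF_sum_pow]
    simp_rw [mul_assoc, ← Finset.mul_sum]
    rw [show ∑ l : Fin (k + 1 + 1), c l * mom s t l i = 0 by simpa [hr] using h.symm, mul_zero]
  · have h := hc (r 0)
    rw [borderedDet_self r (by omega)] at h
    rw [hR, LF_sum_pow]
    simp_rw [mul_assoc, ← Finset.mul_sum]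
    rw [show ∑ l : Fin (k + 1 + 1), c l * phi s t l = 0 by simpa [hr] using h.symm, mul_zero]
  · have key := borderedDet_plucker (fun j i => mom s t i j) (phi s t) k h₁ (fun i => x ^ i)
    have hτ : borderedDet (fun j i => mom s t i j) k (fun i => mom s t i k) = tau s t (k + 1) :=
      borderedDet_eq_det _ k
    have hσ : ∀ m, borderedDet (fun j i => mom s t i j) m (phi s t) = sig s t m := fun _ => rfl
    have hP : ∀ m, P s t m x =
        1 / tau s t m * borderedDet (fun j i => mom s t i j) m (fun i => x ^ i) := fun _ => rfl
    rw [hτ, hσ, hσ] at key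
    rw [R_succ_eq, hP, hP]
    field_simp
    linear_combination key
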